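/- Let N ≥ 1 be an integer, let ρ_N be the unscaled GUE eigenvalue density, and define the exponential generating function u(t) = ∫_ℝ e^{t·x}·ρ_N(x) dx (the integral converges for every real t). Then u is smooth and satisfies, for every real t, the differential equation t·u''(t) + 3·u'(t) − t·(t² + 4N)·u(t) = 0, with u(0) = N and u'(0) = 0. -/

import Mathlib

open Nat MeasureTheory

/-- The orthonormal Hermite functions' polynomial part:
`p_n(x) = He_n(x)/√(√(2π)·n!)`, orthonormal for the weight `e^{-x²/2}` on `ℝ`. -/
noncomputable def pOrtho (n : ℕ) (x : ℝ) : ℝ :=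
  Polynomial.aeval x (Polynomial.hermite n) /
    Real.sqrt (Real.sqrt (2 * Real.pi) * (n ! : ℝ))

/-- The (unscaled) GUE eigenvalue density
`ρ_N(x) = √N · e^{-x²/2} · (p_N'(x)p_{N-1}(x) − p_N(x)p_{N-1}'(x))`. -/
noncomputable def gueDensity (N : ℕ) (x : ℝ) : ℝ :=
  Real.sqrt N * Real.exp (-x ^ 2 / 2) *
    (deriv (pOrtho N) x * pOrtho (N - 1) x - pOrtho N x * deriv (pOrtho (N - 1)) x)

/-- The exponential generating function `u(t) = ∫_ℝ e^{tx} ρ_N(x) dx` of the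
GUE moments. -/
noncomputable def gueEGF (N : ℕ) (t : ℝ) : ℝ :=
  ∫ x : ℝ, Real.exp (t * x) * gueDensity N x

section GaussianTransform

open Polynomial ProbabilityTheory

lemma integrable_eval_mul_exp_gaussianReal (p : ℝ[X]) (t : ℝ) :
    Integrable (fun x ↦ p.eval x * Real.exp (t * x)) (gaussianReal 0 1) := by
  induction p using Polynomial.induction_on' with
  | add p q hp hq => simpa only [eval_add, add_mul] using! hp.add hq
  | monomial n c =>
    have h := integrable_pow_mul_exp_of_mem_interior_integrableExpSet
      (X := fun x : ℝ ↦ x) (μ := gaussianReal 0 1) (v := t) (by simp) n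
    simpa only [eval_monomial, mul_assoc] using h.const_mul c

/-- The two-sided Laplace transform `∫ p(x) e^{tx} dγ(x)` of a polynomial against the standard
Gaussian measure `γ`, as a linear functional of the polynomial. -/
noncomputable def gaussianTransform (t : ℝ) : ℝ[X] →ₗ[ℝ] ℝ where
  toFun p := ∫ x, p.eval x * Real.exp (t * x) ∂gaussianReal 0 1
  map_add' p q := by
    simp only [eval_add, add_mul]
    exact integral_add (integrable_eval_mul_exp_gaussianReal p t)
      (integrable_eval_mul_exp_gaussianReal q t)
  map_smul' c p := by
    simp only [eval_smul, smul_eq_mul, mul_assoc, integral_const_mul, RingHom.id_apply]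

lemma gaussianTransform_apply (t : ℝ) (p : ℝ[X]) :
    gaussianTransform t p = ∫ x, p.eval x * Real.exp (t * x) ∂gaussianReal 0 1 := rfl

lemma gaussianTransform_natCast_mul (t : ℝ) (k : ℕ) (p : ℝ[X]) :
    gaussianTransform t ((k : ℝ[X]) * p) = k * gaussianTransform t p := by
  rw [← nsmul_eq_mul, map_nsmul, nsmul_eq_mul]

lemma gaussianTransform_one (t : ℝ) : gaussianTransform t 1 = Real.exp (t ^ 2 / 2) := by
  have h := congrFun (mgf_fun_id_gaussianReal (μ := 0) (v := 1)) t
  simpa [mgf, gaussianTransform_apply] using h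

lemma hasDerivAt_gaussianTransform (p : ℝ[X]) (t : ℝ) :
    HasDerivAt (fun s ↦ gaussianTransform s p) (gaussianTransform t (X * p)) t := by
  induction p using Polynomial.induction_on' with
  | add p q hp hq => simpa only [mul_add, map_add] using! hp.add hq
  | monomial n c =>
    have h := (hasDerivAt_integral_pow_mul_exp_real
      (X := fun x : ℝ ↦ x) (μ := gaussianReal 0 1) (t := t) (by simp) n).const_mul c
    simpa only [gaussianTransform_apply, X_mul_monomial, eval_monomial, mul_assoc,
      integral_const_mul] using h

lemma deriv_gaussianTransform (p : ℝ[X]) :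
    deriv (fun s ↦ gaussianTransform s p) = fun s ↦ gaussianTransform s (X * p) :=
  funext fun t ↦ (hasDerivAt_gaussianTransform p t).deriv

lemma contDiff_gaussianTransform (p : ℝ[X]) :
    ContDiff ℝ (⊤ : ℕ∞) (fun s ↦ gaussianTransform s p) := by
  rw [contDiff_infty]
  intro n
  induction n generalizing p with
  | zero =>
    exact contDiff_zero.2 (continuous_iff_continuousAt.2
      fun t ↦ (hasDerivAt_gaussianTransform p t).continuousAt)
  | succ n ih =>
    push_cast
    rw [contDiff_succ_iff_deriv, deriv_gaussianTransform]
    exact ⟨fun t ↦ (hasDerivAt_gaussianTransform p t).differentiableAt, by simp, ih _⟩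

/-- Gaussian integration by parts. -/
lemma mul_gaussianTransform (p : ℝ[X]) (t : ℝ) :
    t * gaussianTransform t p = gaussianTransform t (X * p - derivative p) := by
  induction p using Polynomial.induction_on generalizing t with
  | C c =>
    have h1 : HasDerivAt (fun s ↦ gaussianTransform s 1) (t * gaussianTransform t 1) t := by
      simp only [gaussianTransform_one]
      convert ((hasDerivAt_pow 2 t).div_const 2).exp using 1
      push_cast
      ring
    have h2 := h1.unique (hasDerivAt_gaussianTransform 1 t)
    have h3 : (C c : ℝ[X]) = c • 1 := by rw [smul_eq_C_mul, mul_one]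
    rw [derivative_C, sub_zero, h3, mul_smul_comm, map_smul, map_smul, ← h2, smul_eq_mul,
      smul_eq_mul]
    ring
  | add p q hp hq =>
    rw [map_add, mul_add, hp, hq, ← map_add]
    congr 1
    rw [derivative_add]
    ring
  | monomial n c ih =>
    have hX : C c * X ^ (n + 1) = X * (C c * X ^ n) := by ring
    rw [hX]
    generalize C c * X ^ n = p at ih
    have h1 := (hasDerivAt_id t).mul (hasDerivAt_gaussianTransform p t)
    have h2 := hasDerivAt_gaussianTransform (X * p - derivative p) t
    have h3 := h1.unique (h2.congr_of_eventuallyEq (.of_forall fun s ↦ ih s))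
    simp only [id_eq, one_mul, derivative_mul, derivative_X, mul_sub, map_sub, map_add] at h3 ⊢
    linear_combination h3

end GaussianTransform

section Hermite

open Polynomial

lemma Polynomial.derivative_hermite_succ (n : ℕ) :
    derivative (hermite (n + 1)) = ((n + 1 : ℕ) : ℤ[X]) * hermite n := by
  induction n with
  | zero => simp
  | succ n ih =>
    rw [hermite_succ (n + 1), derivative_sub, ih, derivative_mul, derivative_mul, ih,
      derivative_natCast, hermite_succ n]
    simp only [derivative_X]
    push_cast
    ring

/-- The Hermite polynomial with real coefficients. -/
noncomputable def realHermite (n : ℕ) : ℝ[X] := (hermite n).map (Int.castRingHom ℝ)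

lemma eval_realHermite (n : ℕ) (x : ℝ) : (realHermite n).eval x = aeval x (hermite n) := by
  rw [realHermite, eval_map, aeval_def, algebraMap_int_eq]

lemma derivative_realHermite_succ (n : ℕ) :
    derivative (realHermite (n + 1)) = ((n + 1 : ℕ) : ℝ[X]) * realHermite n := by
  rw [realHermite, derivative_map, derivative_hermite_succ, Polynomial.map_mul,
    Polynomial.map_natCast, realHermite]

lemma derivative_realHermite (n : ℕ) :
    derivative (realHermite n) = X * realHermite n - realHermite (n + 1) := by
  simp only [realHermite, hermite_succ, Polynomial.map_sub, Polynomial.map_mul, map_X,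
    derivative_map]
  ring

/-- The Wronskian `He_n He_{n+1}' − He_{n+1} He_n'`. -/
noncomputable def hermiteWronskian (n : ℕ) : ℝ[X] :=
  derivative (realHermite (n + 1)) * realHermite n -
    realHermite (n + 1) * derivative (realHermite n)

lemma hermiteWronskian_eq (n : ℕ) :
    hermiteWronskian n = ((n + 1 : ℕ) : ℝ[X]) * realHermite n ^ 2 -
      X * realHermite (n + 1) * realHermite n + realHermite (n + 1) ^ 2 := by
  rw [hermiteWronskian, derivative_realHermite_succ, derivative_realHermite n]
  ring

lemma X_mul_hermiteWronskian_sub_derivative (n : ℕ) :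
    X * hermiteWronskian n - derivative (hermiteWronskian n) =
      realHermite (n + 1) * realHermite n := by
  simp only [hermiteWronskian_eq, derivative_add, derivative_sub, derivative_mul,
    derivative_pow, derivative_natCast, derivative_X, derivative_realHermite_succ,
    derivative_realHermite n]
  simp [map_ofNat]
  ring

lemma hermiteWronskian_succ (n : ℕ) :
    hermiteWronskian (n + 1) =
      ((n + 1 : ℕ) : ℝ[X]) * hermiteWronskian n + realHermite (n + 1) ^ 2 := by
  have h : realHermite (n + 1 + 1) =
      X * realHermite (n + 1) - ((n + 1 : ℕ) : ℝ[X]) * realHermite n := by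
    rw [← derivative_realHermite_succ, derivative_realHermite (n + 1)]
    ring
  rw [hermiteWronskian_eq, hermiteWronskian_eq, h]
  push_cast
  ring

lemma X_mul_sub_derivative_mul_realHermite (n : ℕ) :
    X * (realHermite (n + 1) * realHermite n) - derivative (realHermite (n + 1) * realHermite n) =
      realHermite (n + 1) ^ 2 - ((n + 1 : ℕ) : ℝ[X]) * realHermite n ^ 2 := by
  rw [derivative_mul, derivative_realHermite_succ, derivative_realHermite n]
  ring

lemma gaussianTransform_zero_realHermite_sq (n : ℕ) :
    gaussianTransform 0 (realHermite n ^ 2) = n ! := by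
  induction n with
  | zero => simp [realHermite, gaussianTransform_one]
  | succ n ih =>
    have h := mul_gaussianTransform (realHermite (n + 1) * realHermite n) 0
    rw [X_mul_sub_derivative_mul_realHermite, map_sub, gaussianTransform_natCast_mul, ih] at h
    rw [Nat.factorial_succ]
    push_cast at h ⊢
    linear_combination -h

lemma gaussianTransform_zero_hermiteWronskian (n : ℕ) :
    gaussianTransform 0 (hermiteWronskian n) = (n + 1)! := by
  induction n with
  | zero =>
    have h : hermiteWronskian 0 = 1 := by simp [hermiteWronskian, realHermite]
    simp [h, gaussianTransform_one]
  | succ n ih =>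
    rw [hermiteWronskian_succ, map_add, gaussianTransform_natCast_mul, ih,
      gaussianTransform_zero_realHermite_sq, Nat.factorial_succ (n + 1)]
    push_cast
    ring

lemma gaussianTransform_hermiteWronskian_ode (n : ℕ) (t : ℝ) :
    t * gaussianTransform t (X * (X * hermiteWronskian n)) +
      3 * gaussianTransform t (X * hermiteWronskian n) -
      t * (t ^ 2 + 4 * ((n + 1 : ℕ) : ℝ)) * gaussianTransform t (hermiteWronskian n) = 0 := by
  set a := realHermite (n + 1) with ha
  set b := realHermite n with hb
  set q := hermiteWronskian n with hq
  have hDq : X * q - derivative q = a * b := X_mul_hermiteWronskian_sub_derivative n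
  have h1 : t * gaussianTransform t q = gaussianTransform t (a * b) := by
    rw [mul_gaussianTransform, hDq]
  have h2 : t * gaussianTransform t (a * b) =
      gaussianTransform t (a ^ 2 - ((n + 1 : ℕ) : ℝ[X]) * b ^ 2) := by
    rw [mul_gaussianTransform, X_mul_sub_derivative_mul_realHermite]
  have h3 := mul_gaussianTransform (a ^ 2 - ((n + 1 : ℕ) : ℝ[X]) * b ^ 2) t
  have h4 := mul_gaussianTransform (X * (X * q)) t
  have key : X * (X * (X * q)) - derivative (X * (X * q)) + (X * q + X * q + X * q) -
      (X * (a ^ 2 - ((n + 1 : ℕ) : ℝ[X]) * b ^ 2) -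
        derivative (a ^ 2 - ((n + 1 : ℕ) : ℝ[X]) * b ^ 2)) -
      ((4 : ℕ) : ℝ[X]) * (((n + 1 : ℕ) : ℝ[X]) * (a * b)) = 0 := by
    have hq' : derivative q = X * q - a * b := by rw [← hDq]; ring
    simp only [derivative_sub, derivative_mul, derivative_pow, derivative_natCast, derivative_X,
      hq', ha, hb, derivative_realHermite_succ, derivative_realHermite n]
    simp only [hq, hermiteWronskian_eq]
    simp [map_ofNat]
    ring
  have h5 := congrArg (gaussianTransform t) key
  simp only [map_sub (gaussianTransform t), map_add (gaussianTransform t),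
    gaussianTransform_natCast_mul, map_zero] at h2 h3 h4 h5
  push_cast at *
  linear_combination h5 + h4 - h3 - t * h2 - (t ^ 2 + 4 * ((n : ℝ) + 1)) * h1

end Hermite

section Density

open Polynomial ProbabilityTheory

lemma gueDensity_succ (n : ℕ) (x : ℝ) :
    gueDensity (n + 1) x =
      gaussianPDFReal 0 1 x * ((n ! : ℝ)⁻¹ * (hermiteWronskian n).eval x) := by
  have hp (m : ℕ) : pOrtho m = fun y ↦ (realHermite m).eval y /
      Real.sqrt (Real.sqrt (2 * Real.pi) * (m ! : ℝ)) := by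
    funext y
    rw [pOrtho, eval_realHermite]
  have hd (m : ℕ) : deriv (pOrtho m) x = (derivative (realHermite m)).eval x /
      Real.sqrt (Real.sqrt (2 * Real.pi) * (m ! : ℝ)) := by
    rw [hp, deriv_div_const, Polynomial.deriv]
  have hs : 0 < Real.sqrt (2 * Real.pi) := by positivity
  have hf : (0 : ℝ) < n ! := by positivity
  have hN : (0 : ℝ) < Real.sqrt ((n + 1 : ℕ) : ℝ) := by positivity
  have hsqrt : Real.sqrt (Real.sqrt (2 * Real.pi) * ((n + 1)! : ℝ)) =
      Real.sqrt ((n + 1 : ℕ) : ℝ) * Real.sqrt (Real.sqrt (2 * Real.pi) * (n ! : ℝ)) := by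
    rw [← Real.sqrt_mul (by positivity), Nat.factorial_succ]
    push_cast
    ring_nf
  have hsq := Real.mul_self_sqrt (mul_pos hs hf).le
  have hr : 0 < Real.sqrt (Real.sqrt (2 * Real.pi) * (n ! : ℝ)) := by positivity
  rw [gueDensity, hd, hd, Nat.add_sub_cancel, hp, hp, hsqrt, gaussianPDFReal, hermiteWronskian,
    eval_sub, eval_mul, eval_mul]
  simp only [NNReal.coe_one, mul_one, sub_zero]
  generalize Real.sqrt (Real.sqrt (2 * Real.pi) * (n ! : ℝ)) = r at hsq hr
  rw [← mul_assoc, mul_right_comm _ _ ((n ! : ℝ)⁻¹), ← mul_inv, ← hsq]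
  field_simp

lemma exp_mul_gueDensity_succ (n : ℕ) (t x : ℝ) :
    Real.exp (t * x) * gueDensity (n + 1) x = gaussianPDFReal 0 1 x •
      ((n ! : ℝ)⁻¹ * ((hermiteWronskian n).eval x * Real.exp (t * x))) := by
  rw [gueDensity_succ, smul_eq_mul]
  ring

lemma integrable_exp_mul_gueDensity_succ (n : ℕ) (t : ℝ) :
    Integrable (fun x : ℝ ↦ Real.exp (t * x) * gueDensity (n + 1) x) := by
  have h := (integrable_eval_mul_exp_gaussianReal (hermiteWronskian n) t).const_mul (n ! : ℝ)⁻¹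
  rw [gaussianReal_of_var_ne_zero 0 one_ne_zero, integrable_withDensity_iff_integrable_smul'
    (measurable_gaussianPDF 0 1) (.of_forall fun _ ↦ gaussianPDF_lt_top)] at h
  simpa only [exp_mul_gueDensity_succ, toReal_gaussianPDF] using h

lemma gueEGF_succ (n : ℕ) :
    gueEGF (n + 1) = fun t ↦ (n ! : ℝ)⁻¹ * gaussianTransform t (hermiteWronskian n) := by
  funext t
  rw [gaussianTransform_apply, ← integral_const_mul,
    integral_gaussianReal_eq_integral_smul one_ne_zero, gueEGF]
  simp only [exp_mul_gueDensity_succ]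

end Density

/-- The GUE exponential generating function is well defined (the integral
converges for every real `t`), is smooth, and satisfies
`t·u'' + 3u' − t(t² + 4N)u = 0` with `u(0) = N`, `u'(0) = 0`. -/
theorem gueEGF_ode (N : ℕ) (hN : 1 ≤ N) :
    (∀ t : ℝ, Integrable (fun x : ℝ => Real.exp (t * x) * gueDensity N x)) ∧
    ContDiff ℝ (⊤ : ℕ∞) (gueEGF N) ∧
    (∀ t : ℝ, t * iteratedDeriv 2 (gueEGF N) t + 3 * deriv (gueEGF N) t -
        t * (t ^ 2 + 4 * (N : ℝ)) * gueEGF N t = 0) ∧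
    gueEGF N 0 = N ∧ deriv (gueEGF N) 0 = 0 := by
  obtain ⟨n, rfl⟩ : ∃ n, N = n + 1 := ⟨N - 1, by omega⟩
  have hderiv (p : Polynomial ℝ) : deriv (fun s ↦ (n ! : ℝ)⁻¹ * gaussianTransform s p) =
      fun s ↦ (n ! : ℝ)⁻¹ * gaussianTransform s (Polynomial.X * p) :=
    funext fun t ↦ ((hasDerivAt_gaussianTransform p t).const_mul _).deriv
  have hode (t : ℝ) : t * iteratedDeriv 2 (gueEGF (n + 1)) t + 3 * deriv (gueEGF (n + 1)) t -
      t * (t ^ 2 + 4 * ((n + 1 : ℕ) : ℝ)) * gueEGF (n + 1) t = 0 := by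
    rw [iteratedDeriv_succ, iteratedDeriv_one, gueEGF_succ, hderiv, hderiv]
    linear_combination (n ! : ℝ)⁻¹ * gaussianTransform_hermiteWronskian_ode n t
  refine ⟨integrable_exp_mul_gueDensity_succ n, ?_, hode, ?_, ?_⟩
  · rw [gueEGF_succ]
    exact contDiff_const.mul (contDiff_gaussianTransform _)
  · rw [gueEGF_succ]
    simp only [gaussianTransform_zero_hermiteWronskian, Nat.factorial_succ, Nat.cast_mul]
    field_simp
  · linear_combination hode 0 / 3
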